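/- Let β ∈ [0,1] and let f ∈ 𝒜_β. Then the Euclidean distance from 0 to the boundary of f(𝔻) satisfies d(0, ∂f(𝔻)) ≥ liminf_{|z|=r→1⁻} |f(z) − f(0)| ≥ −f̃(−1), where −f̃(−1) = 1 − Σ_{n≥2} (2(−1)^n/(n−β(n−1))). -/

import Mathlib

open Metric Filter Set

noncomputable def tcoef (β : ℝ) (n : ℕ) : ℝ :=
  if n = 0 then 0 else if n = 1 then 1 else 2 / ((n : ℝ) - β * ((n : ℝ) - 1))

/-- The class `𝒜_β`: analytic `f(z) = z + ∑_{n≥2} aₙ zⁿ` on the unit disk with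
`Re (β f(z)/z + (1-β) f'(z)) > 0`. -/
def IsAbeta (β : ℝ) (a : ℕ → ℂ) (f : ℂ → ℂ) : Prop :=
  a 0 = 0 ∧ a 1 = 1 ∧
  (∀ z ∈ Metric.ball (0 : ℂ) 1, HasSum (fun n => a n * z ^ n) (f z)) ∧
  ∀ z ∈ Metric.ball (0 : ℂ) 1, z ≠ 0 →
    0 < ((β : ℂ) * f z / z + (1 - (β : ℂ)) * deriv f z).re

theorem hasFPowerSeriesOnBall_of_hasSum {a : ℕ → ℂ} {f : ℂ → ℂ}
    (h : ∀ z ∈ ball (0 : ℂ) 1, HasSum (fun n => a n * z ^ n) (f z)) :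
    HasFPowerSeriesOnBall f (FormalMultilinearSeries.ofScalars ℂ a) 0 1 := by
  refine ⟨ENNReal.le_of_forall_nnreal_lt fun r hr => ?_, one_pos, fun {y} hy => ?_⟩
  · have hr1 : (r : ℝ) < 1 := by exact_mod_cast hr
    have hs := (h (r : ℝ) (by simpa using hr1)).summable.tendsto_atTop_zero.norm
    refine FormalMultilinearSeries.le_radius_of_tendsto _ (l := ‖(0 : ℂ)‖) (hs.congr fun n => ?_)
    simp
  · have hy' : y ∈ ball (0 : ℂ) 1 := by
      rwa [← Metric.eball_ofReal, ENNReal.ofReal_one]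
    simpa [FormalMultilinearSeries.ofScalars_apply_eq, mul_comm] using h y hy'

theorem harnack_lower {p : ℂ → ℂ} (hd : DifferentiableOn ℂ p (ball 0 1)) (h0 : p 0 = 1)
    (hp : ∀ z ∈ ball (0 : ℂ) 1, 0 < (p z).re) {z : ℂ} (hz : z ∈ ball (0 : ℂ) 1) :
    (1 - ‖z‖) / (1 + ‖z‖) ≤ (p z).re := by
  have hne : ∀ z ∈ ball (0 : ℂ) 1, p z + 1 ≠ 0 := fun z hz h => by
    have := congrArg Complex.re h
    have := hp z hz
    simp at *; linarith
  have hlt : ∀ z ∈ ball (0 : ℂ) 1, ‖p z - 1‖ < ‖p z + 1‖ := fun z hz => by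
    have := hp z hz
    rw [← sq_lt_sq₀ (norm_nonneg _) (norm_nonneg _), Complex.sq_norm, Complex.sq_norm,
      Complex.normSq_apply, Complex.normSq_apply]
    simp; nlinarith
  have hS := Complex.norm_le_norm_of_mapsTo_ball (f := fun z => (p z - 1) / (p z + 1)) (z := z)
    (R := 1) ((hd.sub_const 1).div (hd.add_const 1) hne)
    (fun w hw => by
      simp only [mem_closedBall, dist_zero_right, norm_div]
      exact div_le_one_of_le₀ (hlt w hw).le (norm_nonneg _)) (by simp [h0]) (by simpa using hz)
  have hz1 : ‖z‖ < 1 := by simpa using hz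
  have hz0 := norm_nonneg z
  rw [norm_div, div_le_iff₀ (norm_pos_iff.2 (hne z hz)), ← sq_le_sq₀ (norm_nonneg _)
    (by positivity), mul_pow, Complex.sq_norm (p z - 1), Complex.sq_norm (p z + 1), Complex.normSq_apply,
    Complex.normSq_apply] at hS
  simp only [Complex.sub_re, Complex.one_re, Complex.sub_im, Complex.one_im, sub_zero,
    Complex.add_re, Complex.add_im, add_zero] at hS
  have := hp z hz
  rw [div_le_iff₀ (by positivity)]
  by_contra! hc
  have h1 : 0 ≤ (1 - ‖z‖ ^ 2) * ((p z).im * (p z).im) :=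
    mul_nonneg (by nlinarith) (mul_self_nonneg _)
  have h2 : 0 < ((1 - ‖z‖) - (p z).re * (1 + ‖z‖)) * ((1 + ‖z‖) - (p z).re * (1 - ‖z‖)) :=
    mul_pos (by linarith) (by nlinarith)
  nlinarith

/-- The value `-f̃(-1)` in integral form. -/
noncomputable def radiusIntegral (α : ℝ) : ℝ := ∫ t in (0 : ℝ)..1, (1 - t ^ α) / (1 + t ^ α)

theorem sum_alternating_eq (x : ℝ) (hx : 1 + x ≠ 0) (n : ℕ) :
    1 + 2 * ∑ k ∈ Finset.range n, (-x) ^ (k + 1) =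
      (1 - x) / (1 + x) - 2 * (-x) ^ (n + 1) / (1 + x) := by
  induction n with
  | zero => field_simp; simp; ring
  | succ n ih =>
    rw [Finset.sum_range_succ, mul_add, ← add_assoc, ih]
    field_simp
    ring

theorem integral_rpow_pow {α : ℝ} (hα : 0 < α) (k : ℕ) :
    ∫ t in (0 : ℝ)..1, (t ^ α) ^ k = 1 / (1 + α * k) := by
  have : EqOn (fun t : ℝ => (t ^ α) ^ k) (fun t => t ^ (α * k)) (uIcc 0 1) := fun t ht => by
    rw [uIcc_of_le zero_le_one] at ht
    simp [Real.rpow_mul ht.1]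
  have h0 : 0 ≤ α * k := by positivity
  rw [intervalIntegral.integral_congr this, integral_rpow (Or.inl (by linarith)),
    Real.one_rpow, Real.zero_rpow (by linarith)]
  ring

theorem continuous_kernel {α : ℝ} (hα : 0 < α) :
    ContinuousOn (fun t : ℝ => (1 - t ^ α) / (1 + t ^ α)) (Icc 0 1) := by
  have := (Real.continuous_rpow_const hα.le).continuousOn (s := Icc (0 : ℝ) 1)
  refine (continuousOn_const.sub this).div (continuousOn_const.add this) fun t ht => ?_
  have := Real.rpow_nonneg ht.1 α
  positivity

theorem tendsto_alternating_sum {α : ℝ} (hα : 0 < α) :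
    Tendsto (fun n : ℕ => 1 + 2 * ∑ k ∈ Finset.range n, (-1 : ℝ) ^ (k + 1) / (1 + α * (k + 1 : ℕ)))
      atTop (nhds (radiusIntegral α)) := by
  have hc := Real.continuous_rpow_const hα.le
  have hi : ∀ k : ℕ, IntervalIntegrable (fun t : ℝ => (t ^ α) ^ k) MeasureTheory.volume 0 1 :=
    fun k => (hc.pow k).intervalIntegrable _ _
  have hK : IntervalIntegrable (fun t : ℝ => (1 - t ^ α) / (1 + t ^ α))
      MeasureTheory.volume 0 1 :=
    ContinuousOn.intervalIntegrable (by simpa using continuous_kernel hα)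
  have key : ∀ n : ℕ, 1 + 2 * ∑ k ∈ Finset.range n, (-1 : ℝ) ^ (k + 1) / (1 + α * (k + 1 : ℕ)) =
      ∫ t in (0 : ℝ)..1, 1 + 2 * ∑ k ∈ Finset.range n, (-(t ^ α)) ^ (k + 1) := fun n => by
    simp_rw [neg_pow ((_ : ℝ) ^ α)]
    rw [intervalIntegral.integral_add (by simp)
      (by apply Continuous.intervalIntegrable; fun_prop), intervalIntegral.integral_const_mul,
      intervalIntegral.integral_finsetSum fun k _ => (hi _).const_mul _]
    simp_rw [intervalIntegral.integral_const_mul, integral_rpow_pow hα]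
    simp [div_eq_mul_inv]
  have hlim : Tendsto (fun n : ℕ => 2 * (1 / (1 + α * (n + 1 : ℕ)))) atTop (nhds 0) := by
    have h1 : Tendsto (fun n : ℕ => 1 + α * (n : ℝ)) atTop atTop :=
      tendsto_atTop_add_const_left _ _ (tendsto_natCast_atTop_atTop.const_mul_atTop hα)
    simpa using ((tendsto_inv_atTop_zero.comp h1).comp (tendsto_add_atTop_nat 1)).const_mul 2
  rw [tendsto_iff_norm_sub_tendsto_zero]
  refine squeeze_zero (fun _ => norm_nonneg _) (fun n => ?_) hlim
  rw [key, radiusIntegral, ← intervalIntegral.integral_sub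
    (by apply Continuous.intervalIntegrable; fun_prop) hK, ← integral_rpow_pow hα,
    ← intervalIntegral.integral_const_mul]
  refine intervalIntegral.norm_integral_le_of_norm_le zero_le_one (.of_forall fun t ht => ?_)
    ((hi _).const_mul _)
  have ht0 := Real.rpow_nonneg ht.1.le α
  rw [sum_alternating_eq _ (by positivity), sub_right_comm, sub_self, zero_sub, norm_neg, norm_div,
    norm_mul, norm_pow, norm_neg, Real.norm_of_nonneg ht0, Real.norm_two,
    Real.norm_of_nonneg (by positivity : 0 ≤ 1 + t ^ α)]
  exact div_le_self (by positivity) (by linarith)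

theorem lt_one_of_tendsto {β : ℝ} (hβ : β ∈ Set.Icc (0 : ℝ) 1) {L : ℝ}
    (hL : Tendsto (fun N => ∑ n ∈ Finset.range N, tcoef β n * (-1 : ℝ) ^ n) atTop (nhds L)) :
    β < 1 := by
  refine lt_of_le_of_ne hβ.2 ?_
  rintro rfl
  have h := ((hL.comp (tendsto_add_atTop_nat 1)).sub hL).norm
  simp only [Function.comp_apply, Finset.sum_range_succ, add_sub_cancel_left, sub_self,
    norm_zero] at h
  have h2 : (fun n => ‖tcoef 1 n * (-1 : ℝ) ^ n‖) =ᶠ[atTop] fun _ => (2 : ℝ) := by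
    filter_upwards [eventually_ge_atTop 2] with n hn
    simp [tcoef, show n ≠ 0 by omega, show n ≠ 1 by omega]
  have := tendsto_nhds_unique (h.congr' h2) tendsto_const_nhds
  norm_num at this

theorem neg_eq_radiusIntegral {β : ℝ} (hβ : β < 1) {L : ℝ}
    (hL : Tendsto (fun N => ∑ n ∈ Finset.range N, tcoef β n * (-1 : ℝ) ^ n) atTop (nhds L)) :
    -L = radiusIntegral (1 - β) := by
  refine tendsto_nhds_unique ((hL.comp (tendsto_add_atTop_nat 2)).neg)
    ((tendsto_alternating_sum (sub_pos.2 hβ)).congr fun n => ?_)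
  simp only [Function.comp_apply, Finset.sum_range_succ', Finset.mul_sum, neg_add, zero_add,
    ← Finset.sum_neg_distrib]
  have h0 : tcoef β 0 = 0 := if_pos rfl
  have h1 : tcoef β 1 = 1 := by simp [tcoef]
  rw [h0, h1, zero_mul, neg_zero, add_zero, add_comm]
  congr 1
  · refine Finset.sum_congr rfl fun k _ => ?_
    have : (k : ℝ) + 1 + 1 - β * (k + 1) = 1 + (1 - β) * (k + 1) := by ring
    rw [tcoef, if_neg (by omega), if_neg (by omega)]
    push_cast
    rw [add_sub_cancel_right, this]
    ring
  · norm_num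

theorem radiusIntegral_le_re {α : ℝ} (hα : 0 < α) {g : ℂ → ℂ}
    (hg : DifferentiableOn ℂ g (ball 0 1)) (g0 : g 0 = 1)
    (hp : ∀ z ∈ ball (0 : ℂ) 1, 0 < (g z + α * (z * deriv g z)).re) {z : ℂ}
    (hz : z ∈ ball (0 : ℂ) 1) : radiusIntegral α ≤ (g z).re := by
  have hmem : ∀ t ∈ Icc (0 : ℝ) 1, ((t ^ α : ℝ) : ℂ) * z ∈ ball (0 : ℂ) 1 := fun t ht => by
    have h1 := Real.rpow_le_one ht.1 ht.2 hα.le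
    have h0 := Real.rpow_nonneg ht.1 α
    simp only [mem_ball_zero_iff, norm_mul, Complex.norm_real, Real.norm_of_nonneg h0] at hz ⊢
    exact (mul_le_of_le_one_left (norm_nonneg _) h1).trans_lt hz
  have hpd : DifferentiableOn ℂ (fun z => g z + α * (z * deriv g z)) (ball 0 1) :=
    hg.add ((differentiableOn_id.mul (hg.deriv isOpen_ball)).const_mul _)
  have hcont : ContinuousOn (fun t : ℝ => t * (g (((t ^ α : ℝ) : ℂ) * z)).re) (Icc 0 1) := by
    refine continuousOn_id.mul (Complex.continuous_re.comp_continuousOn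
      (hg.continuousOn.comp (Continuous.continuousOn ?_) hmem))
    exact (Complex.continuous_ofReal.comp (Real.continuous_rpow_const hα.le)).mul continuous_const
  have hderiv : ∀ t ∈ Ioo (0 : ℝ) 1, HasDerivWithinAt
      (fun t : ℝ => t * (g (((t ^ α : ℝ) : ℂ) * z)).re)
      ((g (((t ^ α : ℝ) : ℂ) * z) + α * ((((t ^ α : ℝ) : ℂ) * z) *
        deriv g (((t ^ α : ℝ) : ℂ) * z))).re) (Ioi t) t := fun t ht => by
    have h1 : HasDerivAt (fun t : ℝ => ((t ^ α : ℝ) : ℂ) * z)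
        (((α * t ^ (α - 1) : ℝ) : ℂ) * z) t :=
      (Real.hasDerivAt_rpow_const (Or.inl ht.1.ne')).ofReal_comp.mul_const z
    have h2 := ((hg.differentiableAt (isOpen_ball.mem_nhds
      (hmem t ⟨ht.1.le, ht.2.le⟩))).hasDerivAt).scomp t h1
    have h3 := (Complex.reCLM.hasFDerivAt.comp_hasDerivAt t h2)
    have h4 := (hasDerivAt_id t).mul h3
    refine (h4.congr_deriv ?_).hasDerivWithinAt
    have ht' : t * t ^ (α - 1) = t ^ α := by
      rw [mul_comm, ← Real.rpow_add_one ht.1.ne']; simp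
    simp only [← ht', Complex.add_re, smul_eq_mul, id, Function.comp_apply, one_mul,
      Complex.reCLM_apply, ← Complex.re_ofReal_mul t]
    push_cast
    ring_nf
  have := intervalIntegral.integral_le_sub_of_hasDeriv_right_of_le zero_le_one hcont hderiv
    ((continuous_kernel hα).integrableOn_Icc) fun t ht => by
      have ht' := hmem t ⟨ht.1.le, ht.2.le⟩
      refine le_trans ?_ (harnack_lower hpd (by simp [g0]) hp ht')
      have h0 := Real.rpow_nonneg ht.1.le α
      have hle : ‖((t ^ α : ℝ) : ℂ) * z‖ ≤ t ^ α := by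
        rw [norm_mul, Complex.norm_real, Real.norm_of_nonneg h0]
        exact mul_le_of_le_one_right h0 (mem_ball_zero_iff.1 hz).le
      have := norm_nonneg (((t ^ α : ℝ) : ℂ) * z)
      rw [div_le_div_iff₀ (by positivity) (by positivity)]
      nlinarith
  simpa [radiusIntegral] using this

theorem radiusIntegral_pos {α : ℝ} (hα : 0 < α) : 0 < radiusIntegral α := by
  refine intervalIntegral.intervalIntegral_pos_of_pos_on
    (ContinuousOn.intervalIntegrable (by simpa using continuous_kernel hα))
    (fun t ht => ?_) zero_lt_one
  have h0 := Real.rpow_pos_of_pos ht.1 α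
  have h1 := Real.rpow_lt_one ht.1.le ht.2 hα
  exact div_pos (by linarith) (by linarith)

theorem det_smul_one_complex (w : ℂ) : (w • (1 : ℂ →L[ℝ] ℂ)).det = ‖w‖ ^ 2 := by
  rw [Complex.sq_norm, ← Algebra.norm_complex_apply, Algebra.norm_apply]
  congr 1

theorem setLIntegral_reProdIm_eq {φ : ℂ → ℝ} {a b c d : ℝ} (hab : a ≤ b) (hcd : c ≤ d)
    (hφ : ContinuousOn φ (Icc a b ×ℂ Icc c d)) (h0 : ∀ z ∈ Icc a b ×ℂ Icc c d, 0 ≤ φ z) :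
    ∫⁻ z in Icc a b ×ℂ Icc c d, ENNReal.ofReal (φ z) =
      ENNReal.ofReal (∫ x in a..b, ∫ y in c..d, φ (x + y * Complex.I)) := by
  have hc : IsCompact (Icc a b ×ℂ Icc c d) := isCompact_Icc.reProdIm isCompact_Icc
  have hi : MeasureTheory.IntegrableOn φ (Icc a b ×ℂ Icc c d) := hφ.integrableOn_compact hc
  rw [← MeasureTheory.ofReal_integral_eq_lintegral_ofReal hi
    ((MeasureTheory.ae_restrict_iff' hc.measurableSet).2 (.of_forall h0))]
  congr 1
  have hm := Complex.volume_preserving_equiv_real_prod.symm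
  have himg : Complex.measurableEquivRealProd.symm ⁻¹' (Icc a b ×ℂ Icc c d) =
      Icc a b ×ˢ Icc c d := by
    ext p; simp only [mem_preimage, Complex.mem_reProdIm, mem_prod]; rfl
  rw [← hm.setIntegral_preimage_emb (MeasurableEquiv.measurableEmbedding _), himg,
    MeasureTheory.Measure.volume_eq_prod, MeasureTheory.setIntegral_prod]
  · rw [intervalIntegral.integral_of_le hab, MeasureTheory.integral_Icc_eq_integral_Ioc]
    simp_rw [intervalIntegral.integral_of_le hcd, MeasureTheory.integral_Icc_eq_integral_Ioc]
    simp [Complex.measurableEquivRealProd_symm_apply, Complex.mk_eq_add_mul_I]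
  · rw [← himg]
    exact (hm.integrableOn_comp_preimage (MeasurableEquiv.measurableEmbedding _)).2 hi

theorem hasFDerivAt_conj_mul_deriv {H : ℂ → ℂ} {ζ : ℂ} (hH : AnalyticAt ℂ H ζ) :
    HasFDerivAt (fun z => (starRingEnd ℂ) (H z) * deriv H z)
      ((starRingEnd ℂ) (H ζ) • (deriv (deriv H) ζ • (1 : ℂ →L[ℝ] ℂ)) +
        deriv H ζ • ((Complex.conjCLE : ℂ →L[ℝ] ℂ).comp (deriv H ζ • (1 : ℂ →L[ℝ] ℂ)))) ζ :=
  (Complex.conjCLE.hasFDerivAt.comp ζ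
    hH.differentiableAt.hasDerivAt.complexToReal_fderiv).mul
      hH.deriv.differentiableAt.hasDerivAt.complexToReal_fderiv

theorem integral_norm_deriv_sq_of_periodic {H : ℂ → ℂ} {c a b : ℝ}
    (hH : DifferentiableOn ℂ H {z | z.re < c})
    (hper : ∀ z, H (z + 2 * Real.pi * Complex.I) = H z) (hab : a ≤ b) (hb : b < c) :
    2 * ∫ x in a..b, ∫ y in (0 : ℝ)..(2 * Real.pi), ‖deriv H (x + y * Complex.I)‖ ^ 2 =
      (∫ y in (0 : ℝ)..(2 * Real.pi),
        ((starRingEnd ℂ) (H (b + y * Complex.I)) * deriv H (b + y * Complex.I)).re) -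
      ∫ y in (0 : ℝ)..(2 * Real.pi),
        ((starRingEnd ℂ) (H (a + y * Complex.I)) * deriv H (a + y * Complex.I)).re := by
  have hopen : IsOpen {z : ℂ | z.re < c} := isOpen_lt Complex.continuous_re continuous_const
  have han : ∀ z : ℂ, z.re < c → AnalyticAt ℂ H z := fun z hz =>
    hH.analyticAt (hopen.mem_nhds hz)
  have hder : ∀ z, deriv H (z + 2 * Real.pi * Complex.I) = deriv H z := fun z => by
    rw [← deriv_comp_add_const]; simp_rw [hper]
  set F : ℂ → ℂ := fun z => (starRingEnd ℂ) (H z) * deriv H z with hF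
  have hFper : ∀ z, F (z + 2 * Real.pi * Complex.I) = F z := fun z => by simp only [hF, hper, hder]
  have hFd : ∀ z : ℂ, z.re < c → DifferentiableAt ℝ F z := fun z hz =>
    (hasFDerivAt_conj_mul_deriv (han z hz)).differentiableAt
  have hdbar : ∀ z : ℂ, z.re < c → Complex.I • fderiv ℝ F z 1 - fderiv ℝ F z Complex.I =
      ((2 * ‖deriv H z‖ ^ 2 : ℝ) : ℂ) * Complex.I := fun z hz => by
    rw [(hasFDerivAt_conj_mul_deriv (han z hz)).fderiv]
    have h1 : ((2 * ‖deriv H z‖ ^ 2 : ℝ) : ℂ) = 2 * (deriv H z * (starRingEnd ℂ) (deriv H z)) := by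
      rw [Complex.mul_conj, Complex.sq_norm]; push_cast; ring
    rw [h1]
    simp
    ring
  have hlt : ∀ z ∈ uIcc a b ×ℂ uIcc (0 : ℝ) (2 * Real.pi), z.re < c := fun z hz =>
    ((uIcc_of_le hab ▸ hz.1 : z.re ∈ Icc a b).2).trans_lt hb
  have hcont : ContinuousOn (fun z : ℂ => ((2 * ‖deriv H z‖ ^ 2 : ℝ) : ℂ) * Complex.I)
      (uIcc a b ×ℂ uIcc (0 : ℝ) (2 * Real.pi)) := by
    have := ((hH.deriv hopen).continuousOn).mono hlt
    exact (Complex.continuous_ofReal.comp_continuousOn ((this.norm.pow 2).const_mul 2)).mul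
      continuousOn_const
  have hK : IsCompact (uIcc a b ×ℂ uIcc (0 : ℝ) (2 * Real.pi)) :=
    isCompact_uIcc.reProdIm isCompact_uIcc
  have green := Complex.integral_boundary_rect_of_differentiableOn_real F (a : ℂ)
    (b + 2 * Real.pi * Complex.I)
    (fun z hz => (hFd z (hlt z (by simpa using hz))).differentiableWithinAt)
    (by
      simp only [Complex.add_re, Complex.ofReal_re, Complex.add_im, Complex.ofReal_im]
      simp only [Complex.mul_re, Complex.mul_im, Complex.re_ofNat, Complex.ofReal_re,
        Complex.im_ofNat, Complex.ofReal_im, Complex.I_re, Complex.I_im,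
        mul_zero, sub_zero, zero_mul, add_zero, mul_one, sub_self, zero_add]
      exact (hcont.congr fun z hz => hdbar z (hlt z hz)).integrableOn_compact hK)
  simp only [Complex.add_re, Complex.ofReal_re, Complex.add_im, Complex.ofReal_im, Complex.mul_re,
    Complex.mul_im, Complex.re_ofNat, Complex.im_ofNat, Complex.I_re,
    Complex.I_im, mul_zero, sub_zero, zero_mul, add_zero, mul_one, sub_self, zero_add,
    Complex.ofReal_zero, Complex.ofReal_mul, Complex.ofReal_ofNat, hFper, smul_eq_mul] at green
  have hrhs : (∫ x : ℝ in a..b, ∫ y : ℝ in (0 : ℝ)..(2 * Real.pi),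
      Complex.I * fderiv ℝ F (x + y * Complex.I) 1 - fderiv ℝ F (x + y * Complex.I) Complex.I) =
      ((2 * ∫ x in a..b, ∫ y in (0 : ℝ)..(2 * Real.pi),
        ‖deriv H (x + y * Complex.I)‖ ^ 2 : ℝ) : ℂ) * Complex.I := by
    rw [← intervalIntegral.integral_const_mul, ← intervalIntegral.integral_ofReal,
      ← intervalIntegral.integral_mul_const]
    refine intervalIntegral.integral_congr fun x hx => ?_
    rw [← intervalIntegral.integral_const_mul, ← intervalIntegral.integral_ofReal,
      ← intervalIntegral.integral_mul_const]
    refine intervalIntegral.integral_congr fun y hy => hdbar _ (hlt _ ?_)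
    simpa [Complex.mem_reProdIm] using ⟨hx, hy⟩
  have hre : ∀ x : ℝ, x < c → (∫ y in (0 : ℝ)..(2 * Real.pi), F (x + y * Complex.I)).re =
      ∫ y in (0 : ℝ)..(2 * Real.pi), (F (x + y * Complex.I)).re := fun x hx => by
    have : Continuous fun y : ℝ => F (x + y * Complex.I) :=
      continuous_iff_continuousAt.2 fun y =>
        ContinuousAt.comp (f := fun y : ℝ => (x : ℂ) + y * Complex.I)
          (hFd _ (by simpa using hx)).continuousAt (by fun_prop)
    exact (Complex.reCLM.intervalIntegral_comp_comm (this.intervalIntegrable _ _)).symm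
  rw [hrhs] at green
  have := congrArg Complex.im green
  simp only [Complex.sub_im, Complex.I_mul_im, hre b hb, hre a (hab.trans_lt hb),
    Complex.im_ofReal_mul, Complex.I_im, mul_one] at this
  exact this.symm

theorem integral_re_comp_exp {p : ℂ → ℂ} (hp : DifferentiableOn ℂ p (ball 0 1)) {x : ℝ}
    (hx : x < 0) :
    ∫ y in (0 : ℝ)..(2 * Real.pi), (p (Complex.exp (x + y * Complex.I))).re =
      2 * Real.pi * (p 0).re := by
  have hr : Real.exp x < 1 := by simpa using hx
  have hsub : closedBall (0 : ℂ) |Real.exp x| ⊆ ball 0 1 := by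
    rw [abs_of_pos (Real.exp_pos x)]; exact closedBall_subset_ball hr
  have h := (hp.diffContOnCl_ball hsub).circleAverage
  rw [Real.circleAverage_def, inv_smul_eq_iff₀ (by positivity)] at h
  have hm : ∀ y : ℝ, circleMap 0 (Real.exp x) y = Complex.exp (x + y * Complex.I) := fun y => by
    simp [circleMap, Complex.exp_add]
  have hc : Continuous fun y : ℝ => p (circleMap 0 (Real.exp x) y) :=
    hp.continuousOn.comp_continuous (continuous_circleMap _ _) fun y =>
      hsub (by simp [circleMap])
  simp_rw [← hm]
  have := Complex.reCLM.intervalIntegral_comp_comm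
    (hc.intervalIntegrable (μ := MeasureTheory.volume) 0 (2 * Real.pi))
  simp only [Complex.reCLM_apply] at this
  rw [this, h]
  simp

theorem exp_mem_ball {z : ℂ} (hz : z.re < 0) : Complex.exp z ∈ ball (0 : ℂ) 1 := by
  simpa [Complex.norm_exp] using hz

theorem integral_exp_neg_re_mul_le {α : ℝ} (hα : 0 < α) {g : ℂ → ℂ}
    (hg : DifferentiableOn ℂ g (ball 0 1)) (g0 : g 0 = 1)
    (hp : ∀ z ∈ ball (0 : ℂ) 1, 0 < (g z + α * (z * deriv g z)).re)
    (hre : ∀ z ∈ ball (0 : ℂ) 1, 0 < (g z).re) {a b T : ℝ} (hab : a ≤ b) (hb : b < 0)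
    (hT : 0 < T) :
    ∫ x in a..b, ∫ y in (0 : ℝ)..(2 * Real.pi),
      Real.exp (-(g (Complex.exp (x + y * Complex.I))).re / T) *
        ‖Complex.exp (x + y * Complex.I) * deriv g (Complex.exp (x + y * Complex.I))‖ ^ 2 ≤
      8 * Real.pi * T / α := by
  have hpi := Real.pi_pos
  set H : ℂ → ℂ := fun z => Complex.exp (-g (Complex.exp z) / (2 * T)) with hH
  have hnorm : ∀ z, ‖H z‖ ^ 2 = Real.exp (-(g (Complex.exp z)).re / T) := fun z => by
    have h2T : (2 * T : ℂ) = ((2 * T : ℝ) : ℂ) := by push_cast; rfl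
    rw [hH, Complex.norm_exp, ← Real.exp_nat_mul, h2T, Complex.div_ofReal_re, Complex.neg_re]
    congr 1
    push_cast
    field_simp
  have hderiv : ∀ z : ℂ, z.re < 0 → HasDerivAt H
      (H z * (-(Complex.exp z * deriv g (Complex.exp z)) / (2 * T))) z := fun z hz => by
    have h1 := (hg.differentiableAt (isOpen_ball.mem_nhds (exp_mem_ball hz))).hasDerivAt.comp z
      (Complex.hasDerivAt_exp z)
    refine (h1.neg.div_const (2 * T : ℂ)).cexp.congr_deriv ?_
    simp only [hH, mul_comm (deriv g _)]
    rfl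
  have hper : ∀ z, H (z + 2 * Real.pi * Complex.I) = H z := fun z => by
    simp only [hH, Complex.exp_periodic z]
  have hlt : ∀ x y : ℝ, x < 0 → ((x : ℂ) + y * Complex.I).re < 0 := fun x y hx => by simpa using hx
  have key := integral_norm_deriv_sq_of_periodic
    (fun z hz => (hderiv z hz).differentiableAt.differentiableWithinAt) hper hab hb
  have hbound : ∀ x : ℝ, x < 0 → |∫ y in (0 : ℝ)..(2 * Real.pi),
      ((starRingEnd ℂ) (H (x + y * Complex.I)) * deriv H (x + y * Complex.I)).re| ≤
        2 * Real.pi / (T * α) := fun x hx => by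
    have hpd : DifferentiableOn ℂ (fun z => g z + α * (z * deriv g z)) (ball 0 1) :=
      hg.add ((differentiableOn_id.mul (hg.deriv isOpen_ball)).const_mul _)
    have hci : ∀ {q : ℂ → ℂ}, DifferentiableOn ℂ q (ball 0 1) →
        IntervalIntegrable (fun y : ℝ => (q (Complex.exp (x + y * Complex.I))).re)
          MeasureTheory.volume 0 (2 * Real.pi) := fun {q} hq =>
      (Complex.continuous_re.comp (hq.continuousOn.comp_continuous (by fun_prop)
        fun y : ℝ => exp_mem_ball (hlt x y hx))).intervalIntegrable _ _
    have hint : ∫ y in (0 : ℝ)..(2 * Real.pi), ((g (Complex.exp (x + y * Complex.I)) + α *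
        (Complex.exp (x + y * Complex.I) * deriv g (Complex.exp (x + y * Complex.I)))).re +
        (g (Complex.exp (x + y * Complex.I))).re) / (2 * T * α) = 2 * Real.pi / (T * α) := by
      rw [intervalIntegral.integral_div, intervalIntegral.integral_add (hci hpd) (hci hg),
        integral_re_comp_exp hpd hx, integral_re_comp_exp hg hx]
      simp only [g0, zero_mul, mul_zero, add_zero, Complex.one_re]
      field_simp
      ring
    rw [← hint, ← Real.norm_eq_abs]
    refine intervalIntegral.norm_integral_le_of_norm_le (by positivity)
      (.of_forall fun y _ => ?_) (((hci hpd).add (hci hg)).div_const _)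
    set z : ℂ := x + y * Complex.I
    have hz : z.re < 0 := hlt x y hx
    have hp' := hp _ (exp_mem_ball hz)
    have hg' := hre _ (exp_mem_ball hz)
    rw [(hderiv z hz).deriv, ← mul_assoc, mul_comm ((starRingEnd ℂ) (H z)), Complex.mul_conj,
      ← Complex.sq_norm, hnorm, Complex.re_ofReal_mul]
    set e := Real.exp (-(g (Complex.exp z)).re / T)
    have he1 : e ≤ 1 := Real.exp_le_one_iff.2 (by
      rw [neg_div]; exact neg_nonpos.2 (div_nonneg hg'.le hT.le))
    have h2T : (2 * T : ℂ) = ((2 * T : ℝ) : ℂ) := by push_cast; rfl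
    rw [h2T, Complex.div_ofReal_re, norm_mul, Real.norm_of_nonneg (Real.exp_pos _).le]
    refine (mul_le_of_le_one_left (norm_nonneg _) he1).trans ?_
    rw [Complex.add_re, Complex.re_ofReal_mul] at hp' ⊢
    rw [Complex.neg_re, norm_div, norm_neg, Real.norm_of_nonneg (by positivity : 0 ≤ 2 * T),
      div_le_div_iff₀ (by positivity) (by positivity), Real.norm_eq_abs]
    have : |(Complex.exp z * deriv g (Complex.exp z)).re| * α ≤ (g (Complex.exp z)).re +
        α * (Complex.exp z * deriv g (Complex.exp z)).re + (g (Complex.exp z)).re := by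
      rw [← abs_of_pos hα, ← abs_mul, abs_of_pos hα]
      exact abs_le.2 ⟨by linarith, by linarith⟩
    nlinarith
  have hint : ∫ x in a..b, ∫ y in (0 : ℝ)..(2 * Real.pi), ‖deriv H (x + y * Complex.I)‖ ^ 2 =
      (∫ x in a..b, ∫ y in (0 : ℝ)..(2 * Real.pi),
        Real.exp (-(g (Complex.exp (x + y * Complex.I))).re / T) *
          ‖Complex.exp (x + y * Complex.I) * deriv g (Complex.exp (x + y * Complex.I))‖ ^ 2) /
        (4 * T ^ 2) := by
    rw [← intervalIntegral.integral_div]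
    refine intervalIntegral.integral_congr fun x hx => ?_
    rw [← intervalIntegral.integral_div]
    refine intervalIntegral.integral_congr fun y _ => ?_
    have hx0 : x < 0 := ((uIcc_of_le hab ▸ hx : x ∈ Icc a b).2).trans_lt hb
    rw [(hderiv _ (hlt x y hx0)).deriv, norm_mul, mul_pow, hnorm, norm_div, norm_neg, div_pow,
      norm_mul 2, Complex.norm_real, Real.norm_of_nonneg hT.le, Complex.norm_ofNat, mul_pow]
    ring
  rw [hint] at key
  have h1 := abs_le.1 (hbound b hb)
  have h2 := abs_le.1 (hbound a (hab.trans_lt hb))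
  rw [mul_div_assoc', div_eq_iff (by positivity)] at key
  have h3 : 8 * Real.pi * T / α =
      (2 * Real.pi / (T * α) + 2 * Real.pi / (T * α)) * (4 * T ^ 2) / 2 := by
    field_simp
    ring
  rw [h3, le_div_iff₀ two_pos, mul_comm, key]
  exact mul_le_mul_of_nonneg_right (by linarith) (by positivity)

theorem volume_image_inter_le {α : ℝ} (hα : 0 < α) {g : ℂ → ℂ}
    (hg : DifferentiableOn ℂ g (ball 0 1)) (g0 : g 0 = 1)
    (hp : ∀ z ∈ ball (0 : ℂ) 1, 0 < (g z + α * (z * deriv g z)).re)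
    (hre : ∀ z ∈ ball (0 : ℂ) 1, 0 < (g z).re) {b T : ℝ} (hab : -1 ≤ b) (hb : b < 0)
    (hT : 0 < T) {A : Set ℂ} (hA : IsClosed A) (hA1 : ∀ w ∈ A, T ≤ ‖w‖)
    (hA2 : ∀ w ∈ A, ‖w‖ ≤ 2 * T) :
    MeasureTheory.volume ((fun z => Complex.exp z * g (Complex.exp z)) ''
      (Icc (-1) b ×ℂ Icc 0 (2 * Real.pi) ∩
        (fun z => Complex.exp z * g (Complex.exp z)) ⁻¹' A)) ≤
      ENNReal.ofReal (2 * (2 * Real.exp 1 * T) ^ 2) *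
        MeasureTheory.volume ((Ico (-1) 0 ×ℂ Icc 0 (2 * Real.pi)) ∩
          {z : ℂ | T ≤ ‖g (Complex.exp z)‖}) +
      ENNReal.ofReal (2 * Real.exp (2 * Real.exp 1) * (8 * Real.pi * T / α)) := by
  have hpi := Real.pi_pos
  set Φ : ℂ → ℂ := fun z => Complex.exp z * g (Complex.exp z) with hΦ
  set R : Set ℂ := Icc (-1) b ×ℂ Icc 0 (2 * Real.pi) with hR
  set S : Set ℂ := R ∩ Φ ⁻¹' A with hS
  have hRc : IsCompact R := isCompact_Icc.reProdIm isCompact_Icc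
  have hRlt : ∀ z ∈ R, z.re < 0 := fun z hz => hz.1.2.trans_lt hb
  have hderiv : ∀ z : ℂ, z.re < 0 → HasDerivAt Φ
      (Complex.exp z * (g (Complex.exp z) + Complex.exp z * deriv g (Complex.exp z))) z :=
    fun z hz => by
      have h1 := (hg.differentiableAt (isOpen_ball.mem_nhds (exp_mem_ball hz))).hasDerivAt.comp z
        (Complex.hasDerivAt_exp z)
      refine ((Complex.hasDerivAt_exp z).mul h1).congr_deriv ?_
      simp only [Function.comp_apply]
      ring
  have hΦc : ContinuousOn Φ R := fun z hz =>
    (hderiv z (hRlt z hz)).continuousAt.continuousWithinAt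
  have hSm : MeasurableSet S := (hΦc.preimage_isClosed_of_isClosed hRc.isClosed hA).measurableSet
  set W : ℂ → ℝ := fun z => Real.exp (-(g (Complex.exp z)).re / T) *
    ‖Complex.exp z * deriv g (Complex.exp z)‖ ^ 2 with hW
  have hmaps : MapsTo Complex.exp R (ball 0 1) := fun z hz => exp_mem_ball (hRlt z hz)
  have hWc : ContinuousOn W R := by
    have h1 := hg.continuousOn.comp Complex.continuous_exp.continuousOn hmaps
    have h2 := (hg.deriv isOpen_ball).continuousOn.comp Complex.continuous_exp.continuousOn hmaps
    have h3 := Complex.continuous_re.comp_continuousOn h1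
    exact (Real.continuous_exp.comp_continuousOn (h3.neg.div_const T)).mul
      ((Complex.continuous_exp.continuousOn.mul h2).norm.pow 2)
  have hpt : ∀ z ∈ S, ‖Complex.exp z *
      (g (Complex.exp z) + Complex.exp z * deriv g (Complex.exp z))‖ ^ 2 ≤
        2 * (2 * Real.exp 1 * T) ^ 2 + 2 * Real.exp (2 * Real.exp 1) * W z := fun z hz => by
    have hexp1 : ‖Complex.exp z‖ ≤ 1 := (mem_ball_zero_iff.1 (hmaps hz.1)).le
    have hexp2 : Real.exp (-1) ≤ ‖Complex.exp z‖ := by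
      rw [Complex.norm_exp]; exact Real.exp_le_exp.2 hz.1.1.1
    have hgle : ‖g (Complex.exp z)‖ ≤ 2 * Real.exp 1 * T := by
      have h1 : ‖Complex.exp z‖ * ‖g (Complex.exp z)‖ ≤ 2 * T := by
        rw [← norm_mul]; exact hA2 _ hz.2
      have h2 := (mul_le_mul_of_nonneg_right hexp2 (norm_nonneg (g (Complex.exp z)))).trans h1
      rw [Real.exp_neg, inv_mul_le_iff₀ (Real.exp_pos 1)] at h2
      linarith
    have hWge : ‖Complex.exp z * deriv g (Complex.exp z)‖ ^ 2 ≤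
        Real.exp (2 * Real.exp 1) * W z := by
      rw [hW, ← mul_assoc, ← Real.exp_add]
      refine le_mul_of_one_le_left (sq_nonneg _) (Real.one_le_exp ?_)
      have : (g (Complex.exp z)).re / T ≤ 2 * Real.exp 1 :=
        (div_le_iff₀ hT).2 ((Complex.re_le_norm _).trans hgle)
      rw [neg_div]
      linarith
    have h3 : ‖Complex.exp z *
        (g (Complex.exp z) + Complex.exp z * deriv g (Complex.exp z))‖ ≤
          ‖g (Complex.exp z)‖ + ‖Complex.exp z * deriv g (Complex.exp z)‖ := by
      rw [norm_mul]
      exact (mul_le_of_le_one_left (norm_nonneg _) hexp1).trans (norm_add_le _ _)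
    calc _ ≤ (‖g (Complex.exp z)‖ + ‖Complex.exp z * deriv g (Complex.exp z)‖) ^ 2 := by gcongr
      _ ≤ 2 * ‖g (Complex.exp z)‖ ^ 2 + 2 * ‖Complex.exp z * deriv g (Complex.exp z)‖ ^ 2 := by
        nlinarith [sq_nonneg (‖g (Complex.exp z)‖ - ‖Complex.exp z * deriv g (Complex.exp z)‖)]
      _ ≤ 2 * (2 * Real.exp 1 * T) ^ 2 + 2 * (Real.exp (2 * Real.exp 1) * W z) := by gcongr
      _ = _ := by ring
  have hW0 : ∀ z, 0 ≤ W z := fun z => by positivity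
  have hSsub : S ⊆ (Ico (-1) 0 ×ℂ Icc 0 (2 * Real.pi)) ∩ {z : ℂ | T ≤ ‖g (Complex.exp z)‖} :=
    fun z hz => ⟨⟨⟨hz.1.1.1, hRlt z hz.1⟩, hz.1.2⟩, (hA1 _ hz.2).trans (by
      rw [hΦ, norm_mul]
      exact mul_le_of_le_one_left (norm_nonneg _) (mem_ball_zero_iff.1 (hmaps hz.1)).le)⟩
  calc MeasureTheory.volume (Φ '' S)
      ≤ ∫⁻ z in S, ENNReal.ofReal |((Complex.exp z * (g (Complex.exp z) +
          Complex.exp z * deriv g (Complex.exp z))) • (1 : ℂ →L[ℝ] ℂ)).det| :=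
        MeasureTheory.addHaar_image_le_lintegral_abs_det_fderiv _ hSm fun z hz =>
          (hderiv z (hRlt z hz.1)).complexToReal_fderiv.hasFDerivWithinAt
    _ ≤ ∫⁻ z in S, (ENNReal.ofReal (2 * (2 * Real.exp 1 * T) ^ 2) +
          ENNReal.ofReal (2 * Real.exp (2 * Real.exp 1)) * ENNReal.ofReal (W z)) := by
        refine MeasureTheory.setLIntegral_mono' hSm fun z hz => ?_
        rw [det_smul_one_complex, abs_of_nonneg (sq_nonneg _),
          ← ENNReal.ofReal_mul (by positivity), ← ENNReal.ofReal_add (by positivity)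
            (mul_nonneg (by positivity) (hW0 z))]
        exact ENNReal.ofReal_le_ofReal (hpt z hz)
    _ = ENNReal.ofReal (2 * (2 * Real.exp 1 * T) ^ 2) * MeasureTheory.volume S +
          ENNReal.ofReal (2 * Real.exp (2 * Real.exp 1)) * ∫⁻ z in S, ENNReal.ofReal (W z) := by
        rw [MeasureTheory.lintegral_add_left measurable_const, MeasureTheory.setLIntegral_const,
          MeasureTheory.lintegral_const_mul' _ _ ENNReal.ofReal_ne_top]
    _ ≤ _ := by
        rw [ENNReal.ofReal_mul (by positivity : 0 ≤ 2 * Real.exp (2 * Real.exp 1))]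
        gcongr
        refine (MeasureTheory.lintegral_mono_set inter_subset_left).trans ?_
        rw [setLIntegral_reProdIm_eq hab (by positivity) hWc fun z _ => hW0 z]
        exact ENNReal.ofReal_le_ofReal
          (integral_exp_neg_re_mul_le hα hg g0 hp hre hab hb hT)

theorem tendsto_volume_le_norm {q : ℂ → ℂ} (hq : ContinuousOn q {z | z.re < 0}) (a c d : ℝ) :
    Tendsto (fun n : ℕ => (MeasureTheory.volume ((Ico a 0 ×ℂ Icc c d) ∩
      {z : ℂ | n ≤ ‖q z‖})).toReal) atTop (nhds 0) := by
  have hfin : MeasureTheory.volume (Ico a 0 ×ℂ Icc c d) ≠ ⊤ :=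
    ((isBounded_Ico a 0).reProdIm (isBounded_Icc c d)).measure_lt_top.ne
  have hmeas : ∀ n : ℕ, MeasurableSet ((Ico a 0 ×ℂ Icc c d) ∩ {z : ℂ | n ≤ ‖q z‖}) := fun n => by
    have hc : ContinuousOn (fun z => ‖q z‖) (Ico a 0 ×ℂ Icc c d) :=
      hq.norm.mono fun z hz => hz.1.2
    obtain ⟨u, hu, hu'⟩ := continuousOn_iff_isClosed.1 hc (Ici (n : ℝ)) isClosed_Ici
    have hm : MeasurableSet (Ico a 0 ×ℂ Icc c d) :=
      (Complex.measurable_re measurableSet_Ico).inter (Complex.measurable_im measurableSet_Icc)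
    have := hu.measurableSet.inter hm
    rwa [← hu', inter_comm] at this
  have h := MeasureTheory.tendsto_measure_iInter_atTop (μ := MeasureTheory.volume)
    (fun n => (hmeas n).nullMeasurableSet)
    (fun m n hmn => inter_subset_inter_right _ fun z (hz : (n : ℝ) ≤ ‖q z‖) =>
      (Nat.cast_le.2 hmn).trans hz)
    ⟨0, MeasureTheory.measure_ne_top_of_subset inter_subset_left hfin⟩
  have hempty : ⋂ n : ℕ, (Ico a 0 ×ℂ Icc c d) ∩ {z : ℂ | n ≤ ‖q z‖} = ∅ := by
    refine eq_empty_of_forall_notMem fun z hz => ?_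
    obtain ⟨n, hn⟩ := exists_nat_gt ‖q z‖
    exact absurd (mem_iInter.1 hz n).2 (not_le.2 hn)
  rw [hempty, MeasureTheory.measure_empty] at h
  exact (ENNReal.tendsto_toReal ENNReal.zero_ne_top).comp h

theorem exists_exp_eq_of_mem_ball {z : ℂ} (hz : z ∈ ball (0 : ℂ) 1) (hz1 : Real.exp (-1) < ‖z‖) :
    ∃ k : ℕ, ∃ ζ ∈ Icc (-1) (-1 / (k + 1 : ℝ)) ×ℂ Icc 0 (2 * Real.pi), Complex.exp ζ = z := by
  have hzpos : 0 < ‖z‖ := (Real.exp_pos _).trans hz1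
  have hz0 : z ≠ 0 := norm_pos_iff.1 hzpos
  have hlog : Real.log ‖z‖ < 0 := Real.log_neg hzpos (mem_ball_zero_iff.1 hz)
  obtain ⟨k, hk⟩ := exists_nat_one_div_lt (neg_pos.2 hlog)
  have hre : Real.log ‖z‖ ∈ Icc (-1) (-1 / (k + 1 : ℝ)) :=
    ⟨((Real.lt_log_iff_exp_lt hzpos).2 hz1).le, by rw [neg_div]; linarith⟩
  have hpi := Real.pi_pos
  have hm := Complex.neg_pi_lt_arg z
  have hM := Complex.arg_le_pi z
  refine ⟨k, ?_⟩
  rcases le_or_gt 0 z.arg with h | h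
  · exact ⟨Complex.log z, ⟨by simpa [Complex.log_re] using hre, by
      simpa only [Complex.log_im, mem_preimage, mem_Icc] using ⟨h, by linarith⟩⟩,
        Complex.exp_log hz0⟩
  · refine ⟨Complex.log z + 2 * Real.pi * Complex.I, ⟨by simpa [Complex.log_re] using hre, ?_⟩, ?_⟩
    · simpa [Complex.log_im] using ⟨by linarith, by linarith⟩
    · rw [Complex.exp_periodic, Complex.exp_log hz0]

/-- The area of `f(𝔻) ∩ {|w| ≤ R}` grows too slowly in `R` for `f(z) = z g(z)` to be onto. -/
theorem image_mul_ne_univ {α : ℝ} (hα : 0 < α) {g : ℂ → ℂ}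
    (hg : DifferentiableOn ℂ g (ball 0 1)) (g0 : g 0 = 1)
    (hp : ∀ z ∈ ball (0 : ℂ) 1, 0 < (g z + α * (z * deriv g z)).re)
    (hre : ∀ z ∈ ball (0 : ℂ) 1, 0 < (g z).re) :
    (fun z => z * g z) '' ball 0 1 ≠ univ := by
  intro hsurj
  have hpi := Real.pi_pos
  have hsub : closedBall (0 : ℂ) (Real.exp (-1)) ⊆ ball 0 1 :=
    closedBall_subset_ball (Real.exp_lt_one_iff.2 (by norm_num))
  obtain ⟨M, hM⟩ := (isCompact_closedBall (0 : ℂ) (Real.exp (-1))).exists_bound_of_continuousOn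
    (f := fun z => z * g z) (continuousOn_id.mul (hg.continuousOn.mono hsub))
  set v : ℕ → ℝ := fun n => (MeasureTheory.volume ((Ico (-1) 0 ×ℂ Icc 0 (2 * Real.pi)) ∩
    {z : ℂ | n ≤ ‖g (Complex.exp z)‖})).toReal with hv
  have hvlim : Tendsto v atTop (nhds 0) := tendsto_volume_le_norm
    (hg.continuousOn.comp Complex.continuous_exp.continuousOn fun z hz => exp_mem_ball hz) _ _ _
  set C : ℝ := 2 * Real.exp (2 * Real.exp 1) * (8 * Real.pi / α)
  have hkey : ∀ᶠ n : ℕ in atTop,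
      Real.pi / 4 ≤ 2 * (2 * Real.exp 1) ^ 2 * v n + C * (n : ℝ)⁻¹ := by
    filter_upwards [tendsto_natCast_atTop_atTop.eventually_gt_atTop (max M 0)] with n hn
    obtain ⟨hnM, hn0⟩ := max_lt_iff.1 hn
    set A : Set ℂ := closedBall ((3 / 2 * n : ℝ) : ℂ) (n / 2) with hA
    have hcn : ‖((3 / 2 * n : ℝ) : ℂ)‖ = 3 / 2 * n := by
      rw [Complex.norm_real, Real.norm_of_nonneg (by positivity)]
    have hA1 : ∀ w ∈ A, (n : ℝ) ≤ ‖w‖ := fun w hw => by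
      rw [hA, mem_closedBall, dist_eq_norm'] at hw
      have := norm_sub_norm_le ((3 / 2 * n : ℝ) : ℂ) w
      linarith
    have hA2 : ∀ w ∈ A, ‖w‖ ≤ 2 * n := fun w hw => by
      rw [hA, mem_closedBall, dist_eq_norm] at hw
      have := norm_sub_norm_le w ((3 / 2 * n : ℝ) : ℂ)
      linarith
    set U : ℕ → Set ℂ := fun k => (fun z => Complex.exp z * g (Complex.exp z)) ''
      (Icc (-1) (-1 / (k + 1 : ℝ)) ×ℂ Icc 0 (2 * Real.pi) ∩
        (fun z => Complex.exp z * g (Complex.exp z)) ⁻¹' A)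
    have hUmono : Monotone U := fun j k hjk => image_mono (inter_subset_inter_left _ fun z hz =>
      ⟨⟨hz.1.1, hz.1.2.trans (by
        rw [neg_div, neg_div]
        exact neg_le_neg (Nat.one_div_le_one_div hjk))⟩, hz.2⟩)
    have hcover : A ⊆ ⋃ k, U k := fun w hw => by
      obtain ⟨z, hz, rfl⟩ : w ∈ (fun z => z * g z) '' ball 0 1 := hsurj ▸ mem_univ w
      have hz1 : Real.exp (-1) < ‖z‖ := by
        by_contra! h
        exact absurd ((hA1 _ hw).trans (hM z (by simpa using h))) (not_le.2 hnM)
      obtain ⟨k, ζ, hζ, rfl⟩ := exists_exp_eq_of_mem_ball hz hz1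
      exact mem_iUnion.2 ⟨k, ζ, ⟨hζ, hw⟩, rfl⟩
    have hvol := (MeasureTheory.measure_mono (μ := MeasureTheory.volume) hcover).trans
      (hUmono.measure_iUnion.trans_le (iSup_le fun k => volume_image_inter_le hα hg g0 hp hre
        (by rw [neg_div, neg_le_neg_iff]; exact div_le_one_of_le₀ (by simp) (by positivity))
        (by rw [neg_div]; exact neg_neg_of_pos (by positivity)) hn0 isClosed_closedBall hA1 hA2))
    have hfin : MeasureTheory.volume ((Ico (-1) 0 ×ℂ Icc 0 (2 * Real.pi)) ∩
        {z : ℂ | n ≤ ‖g (Complex.exp z)‖}) ≠ ⊤ :=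
      MeasureTheory.measure_ne_top_of_subset inter_subset_left
        ((isBounded_Ico _ _).reProdIm (isBounded_Icc _ _)).measure_lt_top.ne
    rw [Complex.volume_closedBall, ← ENNReal.ofReal_toReal hfin,
      ← ENNReal.ofReal_mul (by positivity),
      ← ENNReal.ofReal_add (by positivity) (by positivity), ← ENNReal.ofReal_pow (by positivity),
      ← ENNReal.ofReal_coe_nnreal, ← ENNReal.ofReal_mul (by positivity),
      ENNReal.ofReal_le_ofReal_iff (by positivity), NNReal.coe_real_pi] at hvol
    refine le_of_mul_le_mul_right ?_ (by positivity : (0 : ℝ) < n ^ 2)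
    calc _ = (n / 2 : ℝ) ^ 2 * Real.pi := by ring
      _ ≤ _ := hvol
      _ = _ := by
        simp only [hv, C]
        field_simp
  have hlim := (hvlim.const_mul (2 * (2 * Real.exp 1) ^ 2)).add
    (tendsto_inv_atTop_nhds_zero_nat.const_mul C)
  have := ge_of_tendsto hlim hkey
  simp only [mul_zero, add_zero] at this
  linarith

theorem le_norm_of_mem_frontier_image_ball {f : ℂ → ℂ} (hf : ContinuousOn f (ball 0 1))
    (ho : IsOpen (f '' ball 0 1)) {b : ℝ}
    (hb : ∀ᶠ z : ℂ in comap (fun z : ℂ => ‖z‖) (nhdsWithin 1 (Iio 1)), b ≤ ‖f z‖)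
    {w : ℂ} (hw : w ∈ frontier (f '' ball 0 1)) : b ≤ ‖w‖ := by
  rw [eventually_comap] at hb
  obtain ⟨δ, hδ, hδb⟩ := mem_nhdsLT_iff_exists_Ioo_subset.1 hb
  have hsub : closedBall (0 : ℂ) δ ⊆ ball 0 1 := closedBall_subset_ball hδ
  have hcl : IsClosed (f '' closedBall 0 δ) :=
    ((isCompact_closedBall 0 δ).image_of_continuousOn (hf.mono hsub)).isClosed
  rw [ho.frontier_eq] at hw
  have hcover : f '' ball 0 1 ⊆ f '' closedBall 0 δ ∪ {v | b ≤ ‖v‖} := by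
    rintro _ ⟨z, hz, rfl⟩
    rcases le_or_gt ‖z‖ δ with h | h
    · exact Or.inl ⟨z, mem_closedBall_zero_iff.2 h, rfl⟩
    · exact Or.inr (hδb ⟨h, mem_ball_zero_iff.1 hz⟩ z rfl)
  rcases closure_minimal hcover (hcl.union (isClosed_le continuous_const continuous_norm)) hw.1
    with h | h
  · exact absurd (image_mono hsub h) hw.2
  · exact h

theorem stmt11 (β : ℝ) (hβ : β ∈ Set.Icc (0 : ℝ) 1)
    (a : ℕ → ℂ) (f : ℂ → ℂ) (hf : IsAbeta β a f)
    -- `L = f̃(-1) = -1 + ∑_{n≥2} 2(-1)ⁿ/(n - β(n-1))`, so that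
    -- `-L = 1 - ∑_{n≥2} 2(-1)ⁿ/(n - β(n-1))`
    (L : ℝ)
    (hL : Filter.Tendsto (fun N => ∑ n ∈ Finset.range N, tcoef β n * (-1 : ℝ) ^ n)
      Filter.atTop (nhds L)) :
    Metric.infDist (0 : ℂ) (frontier (f '' Metric.ball 0 1))
      ≥ Filter.liminf (fun z : ℂ => ‖f z - f 0‖)
          (Filter.comap (fun z : ℂ => ‖z‖) (nhdsWithin 1 (Set.Iio 1))) ∧
    Filter.liminf (fun z : ℂ => ‖f z - f 0‖)
        (Filter.comap (fun z : ℂ => ‖z‖) (nhdsWithin 1 (Set.Iio 1))) ≥ -L := by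
  obtain ⟨ha0, ha1, hsum, hre⟩ := hf
  have hβ1 := lt_one_of_tendsto hβ hL
  have hα : 0 < 1 - β := sub_pos.2 hβ1
  have hmem0 : (0 : ℂ) ∈ ball (0 : ℂ) 1 := mem_ball_self one_pos
  have hps := hasFPowerSeriesOnBall_of_hasSum hsum
  have hfd : DifferentiableOn ℂ f (ball 0 1) := by
    have := hps.differentiableOn
    rwa [← ENNReal.ofReal_one, Metric.eball_ofReal] at this
  have hf0 : f 0 = 0 := by
    have := hps.hasFPowerSeriesAt.coeff_zero ![]
    simpa [ha0] using this.symm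
  have hf1 : deriv f 0 = 1 := by
    simpa [ha1] using hps.hasFPowerSeriesAt.deriv
  set g := dslope f 0 with hgdef
  have hg : DifferentiableOn ℂ g (ball 0 1) :=
    (Complex.differentiableOn_dslope (isOpen_ball.mem_nhds hmem0)).2 hfd
  have g0 : g 0 = 1 := by rw [hgdef, dslope_same, hf1]
  have hfg : f = fun z => z * g z := by
    funext z
    have := sub_smul_dslope f 0 z
    simpa [hf0] using this.symm
  have hp : ∀ z ∈ ball (0 : ℂ) 1, 0 < (g z + ((1 - β : ℝ) : ℂ) * (z * deriv g z)).re := by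
    intro z hz
    rcases eq_or_ne z 0 with rfl | hz0
    · simp [g0]
    · have hd : deriv f z = g z + z * deriv g z := by
        rw [hfg]
        simpa using ((hasDerivAt_id' z).fun_mul
          (hg.differentiableAt (isOpen_ball.mem_nhds hz)).hasDerivAt).deriv
      have h := hre z hz hz0
      rw [hd, congrFun hfg z] at h
      convert h using 2
      push_cast
      field_simp
      ring
  have hgre : ∀ z ∈ ball (0 : ℂ) 1, radiusIntegral (1 - β) ≤ (g z).re := fun z hz =>
    radiusIntegral_le_re hα hg g0 hp hz
  have hne : f '' ball 0 1 ≠ univ := by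
    rw [hfg]
    exact image_mul_ne_univ hα hg g0 hp fun z hz => (radiusIntegral_pos hα).trans_le (hgre z hz)
  have hopen : IsOpen (f '' ball 0 1) := by
    rcases (hfd.analyticOnNhd isOpen_ball).is_constant_or_isOpen
      (convex_ball 0 1).isPreconnected with ⟨w, hw⟩ | h
    · have : deriv f 0 = 0 := by
        rw [(eventuallyEq_of_mem (isOpen_ball.mem_nhds hmem0) hw :
          f =ᶠ[nhds 0] fun _ => w).deriv_eq, deriv_const]
      simp [hf1] at this
    · exact h _ Subset.rfl isOpen_ball
  have hfr : (frontier (f '' ball 0 1)).Nonempty :=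
    nonempty_frontier_iff.2 ⟨⟨_, mem_image_of_mem f hmem0⟩, hne⟩
  simp only [hf0, sub_zero, liminf_eq]
  have hle : ∀ w ∈ frontier (f '' ball 0 1), ∀ b ∈ {b | ∀ᶠ z : ℂ in
      comap (fun z : ℂ => ‖z‖) (nhdsWithin 1 (Iio 1)), b ≤ ‖f z‖}, b ≤ ‖w‖ :=
    fun w hw b hb => le_norm_of_mem_frontier_image_ball hfd.continuousOn hopen hb hw
  refine ⟨(le_infDist hfr).2 fun w hw => ?_, ?_⟩
  · rw [dist_zero_left]
    exact csSup_le ⟨0, by simp⟩ (hle w hw)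
  · obtain ⟨w, hw⟩ := hfr
    rw [neg_eq_radiusIntegral hβ1 hL, ge_iff_le]
    have ht : Tendsto (fun r : ℝ => r * radiusIntegral (1 - β)) (nhdsWithin 1 (Iio 1))
        (nhds (radiusIntegral (1 - β))) := by
      simpa using (tendsto_nhdsWithin_of_tendsto_nhds (tendsto_id (x := nhds (1 : ℝ)))).mul_const
        (radiusIntegral (1 - β))
    refine le_of_tendsto ht (eventually_nhdsWithin_of_forall fun r hr => ?_)
    refine le_csSup ⟨‖w‖, hle w hw⟩ ?_
    refine eventually_comap.2 ?_
    filter_upwards [Ioo_mem_nhdsLT hr] with _ hs z rfl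
    rw [congrFun hfg z, norm_mul]
    have h := (hgre z (mem_ball_zero_iff.2 hs.2)).trans (Complex.re_le_norm _)
    exact mul_le_mul hs.1.le h (radiusIntegral_pos hα).le (norm_nonneg _)
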